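/- arXiv:2209.08137 — 2 statements merged into one kernel-verified Lean document; each statement's English description precedes it below -/
import Mathlib

section
/- Let A ⊆ C(βX) be a norm-closed convex cone containing the nonnegative functions, not containing the constant −1, and closed under the following sequential property: if f_n ∈ A and f_n ↓ f pointwise on X with f ∈ C(βX), then f ∈ A. Let S = { μ ∈ P(βX) : μ(f) ≥ 0 for all f ∈ A }. Then for each compact Baire set M ⊆ βX \ X of the form M = φ^{-1}({1}) with φ ∈ C(βX), 0 ≤ φ ≤ 1, φ < 1 on X, and for each 0 < ε < 1, the set V = { μ ∈ S : μ(M) < ε } is weak*-open and weak*-dense in S. -/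
open Set Topology Filter MeasureTheory

lemma MeasureTheory.ProbabilityMeasure.exists_convex_combination {Y : Type*}
    [MeasurableSpace Y] (μ ν : ProbabilityMeasure Y) {a b : ℝ}
    (ha : 0 ≤ a) (hb : 0 ≤ b) (hab : a + b = 1) :
    ∃ ρ : ProbabilityMeasure Y,
      ρ.toMeasure = ENNReal.ofReal a • μ.toMeasure + ENNReal.ofReal b • ν.toMeasure := by
  refine ⟨⟨_, ⟨?_⟩⟩, rfl⟩
  simp [← ENNReal.ofReal_add ha hb, hab]

section CompactSpace

variable {Y : Type*} [TopologicalSpace Y] [CompactSpace Y] [MeasurableSpace Y] [BorelSpace Y]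

lemma ContinuousMap.integrable_of_compactSpace (μ : Measure Y) [IsFiniteMeasure μ] (f : C(Y, ℝ)) :
    Integrable f μ :=
  (BoundedContinuousFunction.mkOfCompact f).integrable μ

lemma MeasureTheory.ProbabilityMeasure.isInducing_integral_continuousMap :
    IsInducing fun (μ : ProbabilityMeasure Y) (f : C(Y, ℝ)) => ∫ y, f y ∂μ.toMeasure := by
  rw [isInducing_iff_nhds]
  intro μ
  apply le_antisymm
  · exact (_root_.continuous_pi
      ProbabilityMeasure.continuous_integral_continuousMap).continuousAt.tendsto.le_comap
  · refine (ProbabilityMeasure.tendsto_iff_forall_integral_tendsto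
      (F := comap (fun (ν : ProbabilityMeasure Y) (f : C(Y, ℝ)) => ∫ y, f y ∂ν.toMeasure)
        (𝓝 fun f => ∫ y, f y ∂μ.toMeasure)) (μs := id)).2 fun f => ?_
    exact ((continuous_apply (A := fun _ : C(Y, ℝ) => ℝ) f.toContinuousMap).tendsto _).comp tendsto_comap

/-- A positive functional on `C(Y, ℝ)` is a nonnegative multiple of integration against a
probability measure, unless it vanishes. -/
lemma exists_probabilityMeasure_of_nonneg [T2Space Y] (l : C(Y, ℝ) →ₗ[ℝ] ℝ)
    (hl : ∀ f : C(Y, ℝ), (∀ y, 0 ≤ f y) → 0 ≤ l f) (hl1 : 0 < l 1) :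
    ∃ μ : ProbabilityMeasure Y, ∀ f : C(Y, ℝ), ∫ y, f y ∂μ.toMeasure = (l 1)⁻¹ * l f := by
  let L : CompactlySupportedContinuousMap Y ℝ →ₗ[ℝ] ℝ :=
    { toFun := fun f => (l 1)⁻¹ * l f.toContinuousMap
      map_add' := fun f g => by
        rw [← mul_add, ← map_add]; rfl
      map_smul' := fun c f => by
        rw [RingHom.id_apply, smul_eq_mul, mul_left_comm, ← smul_eq_mul c, ← map_smul]; rfl }
  let Λ : CompactlySupportedContinuousMap Y ℝ →ₚ[ℝ] ℝ :=
    PositiveLinearMap.mk₀ L fun f hf => mul_nonneg (inv_nonneg.2 hl1.le) (hl _ fun y => hf y)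
  have hΛ : ∀ f : C(Y, ℝ), ∫ y, f y ∂(RealRMK.rieszMeasure Λ) = (l 1)⁻¹ * l f := fun f =>
    RealRMK.integral_rieszMeasure Λ (CompactlySupportedContinuousMap.continuousMapEquiv f)
  have hfin : IsFiniteMeasure (RealRMK.rieszMeasure Λ) :=
    ⟨isCompact_univ.measure_lt_top⟩
  have hone : IsProbabilityMeasure (RealRMK.rieszMeasure Λ) := by
    have h := hΛ 1
    rw [inv_mul_cancel₀ hl1.ne'] at h
    have h' : (RealRMK.rieszMeasure Λ).real univ = 1 := by simpa using h
    refine ⟨?_⟩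
    rw [← ENNReal.toReal_eq_one_iff]
    exact h'
  exact ⟨⟨_, hone⟩, hΛ⟩

/-- Bipolar theorem for cones in `C(Y, ℝ)` containing all nonnegative functions. -/
lemma PointedCone.mem_closure_of_forall_integral_nonneg [T2Space Y] (K : PointedCone ℝ C(Y, ℝ))
    (hpos : ∀ f : C(Y, ℝ), (∀ y, 0 ≤ f y) → f ∈ K) (g : C(Y, ℝ))
    (hg : ∀ μ : ProbabilityMeasure Y, (∀ f ∈ K, 0 ≤ ∫ y, f y ∂μ.toMeasure) →
      0 ≤ ∫ y, g y ∂μ.toMeasure) :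
    g ∈ closure (K : Set C(Y, ℝ)) := by
  by_contra hgK
  let C : ProperCone ℝ C(Y, ℝ) := ⟨K.closure, isClosed_closure⟩
  obtain ⟨l, hlK, hlg⟩ := C.hyperplane_separation_point (x₀ := g) hgK
  have hl : ∀ f ∈ K, 0 ≤ l f := fun f hf => hlK f (subset_closure hf)
  have hbound : 0 ≤ l (‖g‖ • 1 + g) := hl _ <| hpos _ fun y => by
    have := neg_le_of_abs_le (g.norm_coe_le_norm y)
    simp only [ContinuousMap.add_apply, ContinuousMap.smul_apply, ContinuousMap.one_apply,
      smul_eq_mul]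
    linarith
  have hl1 : 0 < l 1 := by
    rw [map_add, map_smul, smul_eq_mul] at hbound
    by_contra! h
    nlinarith [norm_nonneg g]
  obtain ⟨μ, hμ⟩ := exists_probabilityMeasure_of_nonneg l.toLinearMap
    (fun f hf => hl f (hpos f hf)) hl1
  have h := hg μ fun f hf => by
    rw [hμ]; exact mul_nonneg (inv_nonneg.2 hl1.le) (hl f hf)
  rw [hμ] at h
  exact absurd h (not_le.2 (mul_neg_of_pos_of_neg (inv_pos.2 hl1) hlg))

lemma integral_convex_combination (μ ν ρ : ProbabilityMeasure Y) {a b : ℝ}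
    (ha : 0 ≤ a) (hb : 0 ≤ b)
    (hρ : ρ.toMeasure = ENNReal.ofReal a • μ.toMeasure + ENNReal.ofReal b • ν.toMeasure)
    (f : C(Y, ℝ)) :
    ∫ y, f y ∂ρ.toMeasure = a * ∫ y, f y ∂μ.toMeasure + b * ∫ y, f y ∂ν.toMeasure := by
  rw [hρ, integral_add_measure
    ((f.integrable_of_compactSpace _).smul_measure ENNReal.ofReal_ne_top)
    ((f.integrable_of_compactSpace _).smul_measure ENNReal.ofReal_ne_top),
    integral_smul_measure, integral_smul_measure, ENNReal.toReal_ofReal ha,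
    ENNReal.toReal_ofReal hb, smul_eq_mul, smul_eq_mul]

/-- Separation of a point from the weak* closure of a convex set of probability measures. -/
lemma MeasureTheory.ProbabilityMeasure.exists_integral_separating {V : Set (ProbabilityMeasure Y)}
    (hV : ∀ μ ∈ V, ∀ ν ∈ V, ∀ ρ : ProbabilityMeasure Y, ∀ a b : ℝ, 0 ≤ a → 0 ≤ b → a + b = 1 →
      ρ.toMeasure = ENNReal.ofReal a • μ.toMeasure + ENNReal.ofReal b • ν.toMeasure → ρ ∈ V)
    {μ₀ : ProbabilityMeasure Y} (hμ₀ : μ₀ ∉ closure V) :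
    ∃ f : C(Y, ℝ), ∫ y, f y ∂μ₀.toMeasure < 0 ∧ ∀ μ ∈ V, 0 ≤ ∫ y, f y ∂μ.toMeasure := by
  classical
  rw [mem_closure_iff_nhds] at hμ₀
  push Not at hμ₀
  obtain ⟨t, ht, htV⟩ := hμ₀
  rw [ProbabilityMeasure.isInducing_integral_continuousMap.nhds_eq_comap, mem_comap] at ht
  obtain ⟨s, hs, hst⟩ := ht
  rw [nhds_pi, Filter.mem_pi'] at hs
  obtain ⟨I, w, hw, hws⟩ := hs
  let T : ProbabilityMeasure Y → I → ℝ := fun μ f => ∫ y, f.1 y ∂μ.toMeasure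
  have hconv : Convex ℝ (T '' V) := by
    rintro _ ⟨μ, hμ, rfl⟩ _ ⟨ν, hν, rfl⟩ a b ha hb hab
    obtain ⟨ρ, hρ⟩ := ProbabilityMeasure.exists_convex_combination μ ν ha hb hab
    exact ⟨ρ, hV μ hμ ν hν ρ a b ha hb hab hρ,
      funext fun f => integral_convex_combination μ ν ρ ha hb hρ f.1⟩
  have hnot : T μ₀ ∉ closure (T '' V) := by
    intro h
    have hnhds : univ.pi (fun f : I => w f.1) ∈ 𝓝 (T μ₀) :=
      set_pi_mem_nhds finite_univ fun f _ => hw f.1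
    obtain ⟨_, hx, μ, hμ, rfl⟩ := mem_closure_iff_nhds.1 h _ hnhds
    have : μ ∈ t ∩ V := ⟨hst (hws fun f hf => hx ⟨f, hf⟩ (mem_univ _)), hμ⟩
    rw [htV] at this
    exact this
  obtain ⟨l, u, hl₀, hl⟩ := geometric_hahn_banach_point_closed hconv.closure isClosed_closure hnot
  let g : C(Y, ℝ) := ∑ i : I, l (Pi.single i 1) • i.1
  have hg : ∀ μ : ProbabilityMeasure Y, ∫ y, g y ∂μ.toMeasure = l (T μ) := by
    intro μ
    have h1 : l (T μ) = ∑ i : I, T μ i * l (Pi.single i 1) := by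
      conv_lhs => rw [pi_eq_sum_univ' (T μ), map_sum]
      refine Finset.sum_congr rfl fun i _ => ?_
      rw [map_smul, smul_eq_mul]
    rw [h1]
    simp only [g, ContinuousMap.sum_apply, ContinuousMap.smul_apply, smul_eq_mul]
    rw [integral_finsetSum _ fun i _ => (i.1.integrable_of_compactSpace _).const_mul _]
    refine Finset.sum_congr rfl fun i _ => ?_
    rw [integral_const_mul, mul_comm]
  have hsub : ∀ μ : ProbabilityMeasure Y,
      ∫ y, (g - ContinuousMap.const Y u) y ∂μ.toMeasure = l (T μ) - u := by
    intro μ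
    simp only [ContinuousMap.sub_apply, ContinuousMap.const_apply]
    rw [integral_sub (g.integrable_of_compactSpace _) (integrable_const _), hg]
    simp
  refine ⟨g - ContinuousMap.const Y u, ?_, fun μ hμ => ?_⟩
  · rw [hsub]; linarith
  · rw [hsub]; linarith [hl _ (subset_closure (mem_image_of_mem T hμ))]

/-- The powers of a peak function integrate to the mass of its peak set in the limit. -/
lemma tendsto_integral_pow_peak (φ : C(Y, ℝ)) (hφ : ∀ y, φ y ∈ Icc (0 : ℝ) 1) (μ : Measure Y)
    [IsFiniteMeasure μ] :
    Tendsto (fun n : ℕ => ∫ y, (φ ^ n) y ∂μ) atTop (𝓝 (μ.real (φ ⁻¹' {1}))) := by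
  have hmeas : MeasurableSet (φ ⁻¹' {1}) := (isClosed_singleton.preimage φ.continuous).measurableSet
  rw [← integral_indicator_one hmeas]
  refine tendsto_integral_of_dominated_convergence (fun _ => 1)
    (fun n => ((φ ^ n).integrable_of_compactSpace μ).aestronglyMeasurable) (integrable_const _)
    (fun n => Eventually.of_forall fun y => ?_) (Eventually.of_forall fun y => ?_)
  · rw [ContinuousMap.pow_apply, Real.norm_of_nonneg (pow_nonneg (hφ y).1 n)]
    exact pow_le_one₀ (hφ y).1 (hφ y).2
  · by_cases hy : φ y = 1
    · simp [indicator, hy]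
    · simpa [indicator, hy] using
        tendsto_pow_atTop_nhds_zero_of_lt_one (hφ y).1 (lt_of_le_of_ne (hφ y).2 hy)

lemma measureReal_peak_le_integral_pow (φ : C(Y, ℝ)) (hφ : ∀ y, φ y ∈ Icc (0 : ℝ) 1)
    (μ : Measure Y) [IsFiniteMeasure μ] (n : ℕ) :
    μ.real (φ ⁻¹' {1}) ≤ ∫ y, (φ ^ n) y ∂μ := by
  refine le_of_tendsto (tendsto_integral_pow_peak φ hφ μ) ?_
  filter_upwards [eventually_ge_atTop n] with m hm
  exact integral_mono ((φ ^ m).integrable_of_compactSpace μ) ((φ ^ n).integrable_of_compactSpace μ)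
    fun y => pow_le_pow_of_le_one (hφ y).1 (hφ y).2 hm

end CompactSpace

/-- Key density lemma: for an acceptance cone A ⊆ C(βX) with the sequential closure property
along decreasing sequences on X, the polar set S of probability measures, a compact peak set
M ⊆ βX \ X with peak function φ, and 0 < ε < 1, the set {μ ∈ S : μ(M) < ε} is (relatively)
weak*-open and weak*-dense in S. -/
theorem small_mass_on_remainder_open_dense
    {X : Type*} [TopologicalSpace X] [PolishSpace X]
    [MeasurableSpace (StoneCech X)] [BorelSpace (StoneCech X)]
    (A : Set C(StoneCech X, ℝ))
    (hclosed : IsClosed A) (hconv : Convex ℝ A)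
    (hcone : ∀ f ∈ A, ∀ c : ℝ, 0 ≤ c → c • f ∈ A)
    (hpos : ∀ f : C(StoneCech X, ℝ), (∀ y, 0 ≤ f y) → f ∈ A)
    (hnotneg : ContinuousMap.const (StoneCech X) (-1 : ℝ) ∉ A)
    (hseq : ∀ (f : ℕ → C(StoneCech X, ℝ)) (g : C(StoneCech X, ℝ)),
      (∀ n, f n ∈ A) →
      (∀ x : X, Antitone fun n => f n (stoneCechUnit x)) →
      (∀ x : X, Tendsto (fun n => f n (stoneCechUnit x)) atTop (nhds (g (stoneCechUnit x)))) →
      g ∈ A)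
    (S : Set (ProbabilityMeasure (StoneCech X)))
    (hS : S = {μ | ∀ f ∈ A, 0 ≤ ∫ y, f y ∂μ.toMeasure})
    (φ : C(StoneCech X, ℝ)) (hφ01 : ∀ y, φ y ∈ Set.Icc (0 : ℝ) 1)
    (hφX : ∀ x : X, φ (stoneCechUnit x) < 1)
    (M : Set (StoneCech X)) (hM : M = φ ⁻¹' {1})
    (hMrem : M ⊆ (Set.range (stoneCechUnit : X → StoneCech X))ᶜ)
    (ε : ℝ) (hε0 : 0 < ε) (hε1 : ε < 1)
    (V : Set (ProbabilityMeasure (StoneCech X)))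
    (hV : V = {μ ∈ S | μ.toMeasure M < ENNReal.ofReal ε}) :
    (∃ U : Set (ProbabilityMeasure (StoneCech X)), IsOpen U ∧ V = U ∩ S) ∧
    S ⊆ closure V := by
  have hzero : (0 : C(StoneCech X, ℝ)) ∈ A := hpos 0 fun _ => le_rfl
  have hadd : ∀ f ∈ A, ∀ g ∈ A, f + g ∈ A := fun f hf g hg => by
    have h := hcone _ (hconv hf hg (by norm_num : (0 : ℝ) ≤ 1 / 2)
      (by norm_num : (0 : ℝ) ≤ 1 / 2) (by norm_num)) 2 (by norm_num)
    simpa [smul_add, smul_smul] using h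
  let K : PointedCone ℝ C(StoneCech X, ℝ) :=
    { carrier := A
      zero_mem' := hzero
      add_mem' := fun {f g} hf hg => hadd f hf g hg
      smul_mem' := fun c f hf => hcone f hf c.1 c.2 }
  have hmono : ∀ f ∈ A, ∀ g : C(StoneCech X, ℝ), (∀ y, f y ≤ g y) → g ∈ A :=
    fun f hf g hfg => by
      have := hadd f hf (g - f) (hpos _ fun y => sub_nonneg.2 (hfg y))
      rwa [add_sub_cancel] at this
  have hpow : ∀ (T : ℝ), 0 ≤ T → ∀ (N : ℕ) (h : C(StoneCech X, ℝ)),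
      (∀ n ≥ N, h + T • φ ^ n ∈ A) → h ∈ A := by
    intro T hT N h hh
    refine hseq (fun n => h + T • φ ^ (n + N)) h (fun n => hh _ (by omega)) (fun x m n hmn => ?_)
      fun x => ?_
    · simp only [ContinuousMap.add_apply, ContinuousMap.smul_apply, ContinuousMap.pow_apply,
        smul_eq_mul]
      have := pow_le_pow_of_le_one (hφ01 (stoneCechUnit x)).1 (hφ01 (stoneCechUnit x)).2
        (Nat.add_le_add_right hmn N)
      gcongr
    · have := ((tendsto_pow_atTop_nhds_zero_of_lt_one (hφ01 (stoneCechUnit x)).1 (hφX x)).comp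
        (tendsto_add_atTop_nat N)).const_mul T |>.const_add (h (stoneCechUnit x))
      simpa using this
  have hVmem : ∀ μ : ProbabilityMeasure (StoneCech X),
      μ.toMeasure M < ENNReal.ofReal ε ↔ μ.toMeasure.real (φ ⁻¹' {1}) < ε := fun μ => by
    rw [hM, ENNReal.lt_ofReal_iff_toReal_lt (measure_ne_top _ _)]; rfl
  have hSmem : ∀ μ, μ ∈ S ↔ ∀ f ∈ A, 0 ≤ ∫ y, f y ∂μ.toMeasure := fun μ => by rw [hS]; rfl
  constructor
  · refine ⟨⋃ n : ℕ, {μ | ∫ y, (φ ^ n) y ∂μ.toMeasure < ε}, isOpen_iUnion fun n =>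
      isOpen_Iio.preimage (ProbabilityMeasure.continuous_integral_continuousMap (φ ^ n)), ?_⟩
    ext μ
    rw [hV]
    simp only [mem_ofPred_eq, mem_inter_iff, mem_iUnion, hVmem, and_comm (a := μ ∈ S)]
    refine and_congr_left fun _ => ⟨fun h => ?_, fun ⟨n, hn⟩ => ?_⟩
    · exact ((tendsto_integral_pow_peak φ hφ01 μ.toMeasure).eventually_lt_const h).exists
    · exact (measureReal_peak_le_integral_pow φ hφ01 μ.toMeasure n).trans_lt hn
  obtain ⟨N, ν, hνS, hν⟩ : ∃ N : ℕ, ∃ ν ∈ S, ∫ y, (φ ^ N) y ∂ν.toMeasure < ε / 4 := by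
    by_contra! hcon
    have hmem : ContinuousMap.const (StoneCech X) (-(ε / 4)) ∈ A := by
      refine hpow 1 zero_le_one 0 _ fun n _ => ?_
      rw [← hclosed.closure_eq]
      refine K.mem_closure_of_forall_integral_nonneg hpos _ fun μ hμ => ?_
      have := hcon n μ ((hSmem μ).2 hμ)
      simp only [one_smul, ContinuousMap.add_apply, ContinuousMap.const_apply]
      rw [integral_add (integrable_const _) ((φ ^ n).integrable_of_compactSpace _)]
      simp only [integral_const, probReal_univ, smul_eq_mul]
      linarith
    apply hnotneg
    have := hcone _ hmem (4 / ε) (by positivity)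
    convert this using 1
    ext y
    simp only [ContinuousMap.smul_apply, ContinuousMap.const_apply, smul_eq_mul]
    field_simp
  intro μ₀ hμ₀
  by_contra hnot
  obtain ⟨f, hf₀, hfV⟩ := ProbabilityMeasure.exists_integral_separating (V := V) (by
    intro μ hμ ν hν ρ a b ha hb hab hρ
    rw [hV] at hμ hν ⊢
    refine ⟨(hSmem ρ).2 fun f hf => ?_, (hVmem ρ).2 ?_⟩
    · rw [integral_convex_combination μ ν ρ ha hb hρ]
      exact add_nonneg (mul_nonneg ha ((hSmem μ).1 hμ.1 f hf))
        (mul_nonneg hb ((hSmem ν).1 hν.1 f hf))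
    · have h1 := (hVmem μ).1 hμ.2
      have h2 := (hVmem ν).1 hν.2
      have h3 : ρ.toMeasure.real (φ ⁻¹' {1}) =
          a * μ.toMeasure.real (φ ⁻¹' {1}) + b * ν.toMeasure.real (φ ⁻¹' {1}) := by
        rw [hρ, measureReal_add_apply
          (ENNReal.mul_ne_top ENNReal.ofReal_ne_top (measure_ne_top _ _))
          (ENNReal.mul_ne_top ENNReal.ofReal_ne_top (measure_ne_top _ _)), measureReal_ennreal_smul_apply,
          measureReal_ennreal_smul_apply, ENNReal.toReal_ofReal ha, ENNReal.toReal_ofReal hb]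
      rw [h3]
      exact (convex_Iio ε) h1 h2 ha hb hab) hnot
  have hδ : ∀ δ : ℝ, 0 < δ → f + ContinuousMap.const _ δ ∈ A := by
    intro δ hδ
    have key : ∀ n ≥ N, ∃ t : ℝ, 0 ≤ t ∧
        f + ContinuousMap.const _ δ - t • (ContinuousMap.const _ (ε / 2) - φ ^ n) ∈ A := by
      intro n hn
      let q : C(StoneCech X, ℝ) := ContinuousMap.const _ (ε / 2) - φ ^ n
      have hq : ∀ μ : ProbabilityMeasure (StoneCech X),
          ∫ y, q y ∂μ.toMeasure = ε / 2 - ∫ y, (φ ^ n) y ∂μ.toMeasure := fun μ => by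
        simp only [q, ContinuousMap.sub_apply, ContinuousMap.const_apply]
        rw [integral_sub (integrable_const _) ((φ ^ n).integrable_of_compactSpace _)]
        simp
      let B : PointedCone ℝ C(StoneCech X, ℝ) := K ⊔ Submodule.span _ {q}
      have hKB : K ≤ B := le_sup_left
      have hqB : q ∈ B := (le_sup_right : _ ≤ B) (Submodule.mem_span_singleton_self q)
      have hfB : f ∈ closure (B : Set C(StoneCech X, ℝ)) := by
        refine B.mem_closure_of_forall_integral_nonneg (fun g hg => hKB (hpos g hg)) f
          fun μ hμ => hfV μ ?_
        rw [hV]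
        refine ⟨(hSmem μ).2 fun g hg => hμ g (hKB hg), (hVmem μ).2 ?_⟩
        have h1 := hμ q hqB
        rw [hq] at h1
        linarith [measureReal_peak_le_integral_pow φ hφ01 μ.toMeasure n]
      obtain ⟨b, hb, hfb⟩ := Metric.mem_closure_iff.1 hfB δ hδ
      obtain ⟨k, hk, z, hz, rfl⟩ := Submodule.mem_sup.1 hb
      obtain ⟨t, rfl⟩ := Submodule.mem_span_singleton.1 hz
      refine ⟨t.1, t.2, hmono k hk _ fun y => ?_⟩
      have h1 := (f.dist_apply_le_dist (g := k + t • q) y).trans hfb.le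
      rw [Real.dist_eq] at h1
      have h2 := neg_le_of_abs_le h1
      have h3 : (k + t • q) y = k y + t.1 * q y := rfl
      rw [h3] at h2
      simp only [ContinuousMap.sub_apply, ContinuousMap.add_apply, ContinuousMap.const_apply,
        ContinuousMap.smul_apply, smul_eq_mul]
      simp only [q, ContinuousMap.sub_apply, ContinuousMap.const_apply] at h2
      linarith
    let F : ℝ := ∫ y, f y ∂ν.toMeasure
    let T : ℝ := max 0 (4 / ε * (F + δ))
    refine hpow T (le_max_left _ _) N _ fun n hn => ?_
    obtain ⟨t, ht, htA⟩ := key n hn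
    have htT : t ≤ T := by
      refine le_max_of_le_right ?_
      have h1 := (hSmem ν).1 hνS _ htA
      have h2 : ∫ y, (φ ^ n) y ∂ν.toMeasure ≤ ∫ y, (φ ^ N) y ∂ν.toMeasure :=
        integral_mono ((φ ^ n).integrable_of_compactSpace _)
          ((φ ^ N).integrable_of_compactSpace _)
          fun y => pow_le_pow_of_le_one (hφ01 y).1 (hφ01 y).2 hn
      have h3 : ∫ y, (f + ContinuousMap.const _ δ -
          t • (ContinuousMap.const _ (ε / 2) - φ ^ n) : C(StoneCech X, ℝ)) y ∂ν.toMeasure =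
          F + δ - t * (ε / 2 - ∫ y, (φ ^ n) y ∂ν.toMeasure) := by
        simp only [ContinuousMap.sub_apply, ContinuousMap.add_apply, ContinuousMap.const_apply,
          ContinuousMap.smul_apply, smul_eq_mul]
        have i1 := f.integrable_of_compactSpace ν.toMeasure
        have i2 := (φ ^ n).integrable_of_compactSpace ν.toMeasure
        have i3 : Integrable (fun y => f y + δ) ν.toMeasure := i1.add (integrable_const _)
        have i4 : Integrable (fun y => t * (ε / 2 - (φ ^ n) y)) ν.toMeasure :=
          ((integrable_const _).sub i2).const_mul _
        rw [integral_sub i3 i4, integral_add i1 (integrable_const _),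
          integral_const_mul, integral_sub (integrable_const _) i2]
        simp [F]
      rw [h3] at h1
      have h4 : t * (ε / 4) ≤ F + δ := by nlinarith
      rw [div_mul_eq_mul_div, le_div_iff₀ hε0]
      linarith
    refine hmono _ htA _ fun y => ?_
    simp only [ContinuousMap.sub_apply, ContinuousMap.add_apply, ContinuousMap.const_apply,
      ContinuousMap.smul_apply, ContinuousMap.pow_apply, smul_eq_mul]
    have h1 := mul_le_mul_of_nonneg_right htT (pow_nonneg (hφ01 y).1 n)
    have h2 := mul_nonneg ht hε0.le
    linarith
  have h := (hSmem μ₀).1 hμ₀ _ (hδ (-(∫ y, f y ∂μ₀.toMeasure) / 2) (by linarith))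
  simp only [ContinuousMap.add_apply, ContinuousMap.const_apply] at h
  rw [integral_add (f.integrable_of_compactSpace _) (integrable_const _)] at h
  simp only [integral_const, probReal_univ, smul_eq_mul] at h
  linarith
end

section
/- Let X be a Polish space and u : C_b(X) → ℝ a concave monetary utility function with the Fatou property: u is concave, u(f) ≥ 0 for f ≥ 0, u(f+a) = u(f)+a for constants a, and u(f_n) ↓ u(f) whenever f_n ↓ f pointwise in C_b(X). Then there exists a convex, weak*-lower-semicontinuous function c : P(X) → [0, ∞] on the Borel probability measures of X such that u(f) = inf { ∫ f dμ + c(μ) : μ ∈ P(X) } for all f ∈ C_b(X). -/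
open Set Topology Filter MeasureTheory BoundedContinuousFunction

/-- The distance to the first `j + 1` points of the sequence `x`, scaled by `m + 1` and cut off
at `1`. -/
noncomputable def truncatedInfDist {X : Type*} [MetricSpace X] (x : ℕ → X) (m j : ℕ) : X →ᵇ ℝ :=
  BoundedContinuousFunction.ofNormedAddCommGroup
    (fun y => min 1 ((m + 1 : ℝ) * Metric.infDist y (x '' Iic j)))
    (continuous_const.min (continuous_const.mul (Metric.continuous_infDist_pt _))) 1
    (fun y => by
      have : 0 ≤ (m + 1 : ℝ) * Metric.infDist y (x '' Iic j) :=
        mul_nonneg (by positivity) Metric.infDist_nonneg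
      rw [Real.norm_of_nonneg (le_min zero_le_one this)]
      exact min_le_left _ _)

section TruncatedInfDist

variable {X : Type*} [MetricSpace X] (x : ℕ → X) (m j : ℕ)

theorem truncatedInfDist_apply (y : X) :
    truncatedInfDist x m j y = min 1 ((m + 1 : ℝ) * Metric.infDist y (x '' Iic j)) := rfl

theorem truncatedInfDist_nonneg (y : X) : 0 ≤ truncatedInfDist x m j y :=
  le_min zero_le_one (mul_nonneg (by positivity) Metric.infDist_nonneg)

theorem antitone_truncatedInfDist (y : X) : Antitone fun j => truncatedInfDist x m j y := by
  intro i j hij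
  have hne : (x '' Iic i).Nonempty := ⟨x 0, 0, by simp, rfl⟩
  have := Metric.infDist_le_infDist_of_subset (x := y) (image_mono (f := x) (Iic_subset_Iic.2 hij))
    hne
  simp only [truncatedInfDist_apply]
  exact min_le_min_left _ (mul_le_mul_of_nonneg_left this (by positivity))

theorem tendsto_truncatedInfDist {x : ℕ → X} (hx : DenseRange x) (y : X) :
    Tendsto (fun j => truncatedInfDist x m j y) atTop (𝓝 0) := by
  have h : Tendsto (fun j => Metric.infDist y (x '' Iic j)) atTop (𝓝 0) := by
    rw [Metric.tendsto_atTop]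
    intro ε hε
    obtain ⟨i, hi⟩ := hx.exists_dist_lt y hε
    refine ⟨i, fun j hj => ?_⟩
    rw [Real.dist_0_eq_abs, abs_of_nonneg Metric.infDist_nonneg]
    exact (Metric.infDist_le_dist_of_mem (mem_image_of_mem x (mem_Iic.2 hj))).trans_lt hi
  have h' := (tendsto_const_nhds (x := (1 : ℝ))).min (h.const_mul (m + 1 : ℝ))
  simpa [truncatedInfDist_apply] using h'

theorem exists_dist_lt_of_truncatedInfDist_lt {y : X} (hy : truncatedInfDist x m j y < 1 / 2) :
    ∃ i ≤ j, dist y (x i) < 1 / (m + 1 : ℝ) := by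
  rw [truncatedInfDist_apply, min_lt_iff] at hy
  have hy : (m + 1 : ℝ) * Metric.infDist y (x '' Iic j) < 1 :=
    (hy.resolve_left (by norm_num)).trans (by norm_num)
  have hne : (x '' Iic j).Nonempty := ⟨x 0, 0, by simp, rfl⟩
  have : Metric.infDist y (x '' Iic j) < 1 / (m + 1 : ℝ) := by
    rw [lt_div_iff₀ (by positivity)]
    linarith
  obtain ⟨_, ⟨i, hi, rfl⟩, hd⟩ := (Metric.infDist_lt_iff hne).1 this
  exact ⟨i, hi, hd⟩

/-- An ultrafilter which, for all large `m`, is supported where the truncated distance to finitely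
many points is small, is Cauchy. -/
theorem cauchy_of_eventually_truncatedInfDist_lt (j : ℕ → ℕ) (U : Ultrafilter X)
    (hU : ∀ᶠ m in atTop, {y | truncatedInfDist x m (j m) y < 1 / 2} ∈ U) :
    Cauchy (U : Filter X) := by
  rw [Metric.cauchy_iff]
  refine ⟨inferInstance, fun ε hε => ?_⟩
  have hlim : ∀ᶠ m : ℕ in atTop, 1 / (m + 1 : ℝ) < ε / 2 :=
    (tendsto_one_div_add_atTop_nhds_zero_nat (𝕜 := ℝ)).eventually_lt_const (by positivity)
  obtain ⟨m, hm, hmε⟩ := (hU.and hlim).exists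
  have hcover : (⋃ i ∈ Iic (j m), Metric.ball (x i) (ε / 2)) ∈ U := by
    filter_upwards [hm] with y hy
    obtain ⟨i, hi, hd⟩ := exists_dist_lt_of_truncatedInfDist_lt x m (j m) hy
    exact mem_iUnion₂.2 ⟨i, hi, hd.trans hmε⟩
  obtain ⟨i, -, hi⟩ := (Ultrafilter.finite_biUnion_mem_iff (finite_Iic _)).1 hcover
  refine ⟨_, hi, fun y hy z hz => ?_⟩
  have := dist_triangle_right y z (x i)
  rw [Metric.mem_ball] at hy hz
  linarith

end TruncatedInfDist

section StoneCech

variable {X : Type*} [TopologicalSpace X]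

theorem BoundedContinuousFunction.exists_stoneCech_extension (f : X →ᵇ ℝ) :
    ∃ F : C(StoneCech X, ℝ), ∀ x, F (stoneCechUnit x) = f x := by
  have hmem : ∀ x, f x ∈ Icc (-‖f‖) ‖f‖ := fun x => abs_le.1 (f.norm_coe_le_norm x)
  have hc : Continuous (Set.codRestrict f (Icc (-‖f‖) ‖f‖) hmem) :=
    f.continuous.codRestrict hmem
  refine ⟨⟨fun p => (stoneCechExtend (β := Icc (-‖f‖) ‖f‖) hc p : ℝ),
    continuous_subtype_val.comp (continuous_stoneCechExtend hc)⟩, fun x => ?_⟩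
  simp [stoneCechExtend_stoneCechUnit]

/-- Restriction to `X` of a continuous function on the Stone-Čech compactification. -/
noncomputable def stoneCechRestrict (F : C(StoneCech X, ℝ)) : X →ᵇ ℝ :=
  (BoundedContinuousFunction.mkOfCompact F).compContinuous ⟨stoneCechUnit, continuous_stoneCechUnit⟩

theorem exists_measure_stoneCech [MeasurableSpace (StoneCech X)] [BorelSpace (StoneCech X)]
    (l : (X →ᵇ ℝ) →ₗ[ℝ] ℝ) (hl : ∀ f : X →ᵇ ℝ, (∀ x, 0 ≤ f x) → 0 ≤ l f) :
    ∃ ρ : Measure (StoneCech X), IsFiniteMeasure ρ ∧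
      ∀ F : C(StoneCech X, ℝ), ∫ p, F p ∂ρ = l (stoneCechRestrict F) := by
  let Λ : CompactlySupportedContinuousMap (StoneCech X) ℝ →ₚ[ℝ] ℝ := PositiveLinearMap.mk₀
    { toFun := fun F => l (stoneCechRestrict F.toContinuousMap)
      map_add' := fun F G => by rw [← map_add]; rfl
      map_smul' := fun a F => by rw [RingHom.id_apply, ← map_smul]; rfl }
    (fun F hF => hl _ fun x => hF (stoneCechUnit x))
  have hreg : (RealRMK.rieszMeasure Λ).Regular := inferInstance
  exact ⟨RealRMK.rieszMeasure Λ, inferInstance, fun F => RealRMK.integral_rieszMeasure Λ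
      (CompactlySupportedContinuousMap.continuousMapEquiv F)⟩

end StoneCech

/-- A positive normalized functional on bounded continuous functions of a complete metric space
which is tight, in the sense that it is small on truncated distances to suitable finite sets, is
integration against a probability measure. -/
theorem exists_probabilityMeasure_of_tight {X : Type*} [MetricSpace X] [CompleteSpace X]
    [Nonempty X] [MeasurableSpace X] [BorelSpace X]
    (l : (X →ᵇ ℝ) →ₗ[ℝ] ℝ) (hl : ∀ f : X →ᵇ ℝ, (∀ x, 0 ≤ f x) → 0 ≤ l f)
    (hl1 : l (BoundedContinuousFunction.const X 1) = 1)
    (x : ℕ → X) (j : ℕ → ℕ) (C : ℝ)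
    (hC : ∀ m, 2 ^ m * l (truncatedInfDist x m (j m)) ≤ C) :
    ∃ μ : ProbabilityMeasure X, ∀ f : X →ᵇ ℝ, ∫ y, f y ∂μ.toMeasure = l f := by
  let _ : MeasurableSpace (StoneCech X) := borel _
  have : BorelSpace (StoneCech X) := ⟨rfl⟩
  obtain ⟨ρ, hρ, hint⟩ := exists_measure_stoneCech l hl
  have hint' : ∀ (f : X →ᵇ ℝ) (F : C(StoneCech X, ℝ)), (∀ x, F (stoneCechUnit x) = f x) →
      ∫ p, F p ∂ρ = l f := fun f F h => by
    rw [hint]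
    congr 1
    ext x
    exact h x
  choose G hG using fun m => (truncatedInfDist x m (j m)).exists_stoneCech_extension
  have hG0 : ∀ m p, 0 ≤ G m p := fun m p =>
    denseRange_stoneCechUnit.induction_on p (isClosed_le continuous_const (G m).continuous)
      fun y => by rw [hG]; exact truncatedInfDist_nonneg x m (j m) y
  have hbound : ∀ m, ρ.real {p | 1 / 2 ≤ G m p} ≤ 2 * C * (1 / 2) ^ m := fun m => by
    have h1 := mul_meas_ge_le_integral_of_nonneg (μ := ρ) (f := G m)
      (Eventually.of_forall (hG0 m))
      ((G m).continuous.integrable_of_hasCompactSupport (HasCompactSupport.of_compactSpace _)) (1 / 2)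
    rw [hint' _ _ (hG m)] at h1
    have h2 := hC m
    have h3 : l (truncatedInfDist x m (j m)) ≤ C * (1 / 2) ^ m := by
      rw [one_div, inv_pow, ← div_eq_mul_inv, le_div_iff₀ (by positivity)]
      linarith
    linarith
  have hsum : (∑' m, ρ {p | 1 / 2 ≤ G m p}) ≠ ⊤ := by
    have hs : Summable fun m => ρ.real {p | 1 / 2 ≤ G m p} :=
      Summable.of_nonneg_of_le (fun _ => measureReal_nonneg) hbound
        (summable_geometric_two.mul_left _)
    have := hs.tsum_ofReal_ne_top
    simpa [ofReal_measureReal] using this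
  have hrange : ∀ᵐ p ∂ρ, p ∈ range (stoneCechUnit : X → StoneCech X) := by
    filter_upwards [ae_eventually_notMem hsum] with p hp
    have hne : (comap (stoneCechUnit : X → StoneCech X) (𝓝 p)).NeBot :=
      comap_neBot fun t ht => by
        obtain ⟨_, h, y, rfl⟩ := mem_closure_iff_nhds.1 (denseRange_stoneCechUnit p) t ht
        exact ⟨y, h⟩
    let U := Ultrafilter.of (comap (stoneCechUnit : X → StoneCech X) (𝓝 p))
    have hUp : Tendsto (stoneCechUnit : X → StoneCech X) U (𝓝 p) :=
      tendsto_iff_comap.2 (Ultrafilter.of_le _)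
    have hU : Cauchy (U : Filter X) := by
      refine cauchy_of_eventually_truncatedInfDist_lt x j U ?_
      filter_upwards [hp] with m hm
      have : ∀ᶠ q in 𝓝 p, G m q < 1 / 2 :=
        (G m).continuous.continuousAt.eventually_lt_const (not_le.1 hm)
      filter_upwards [hUp.eventually this] with y hy
      rwa [hG] at hy
    obtain ⟨y, hy⟩ := CompleteSpace.complete hU
    exact ⟨y, tendsto_nhds_unique
      ((continuous_stoneCechUnit.tendsto y).mono_left hy) hUp⟩
  obtain ⟨S, hSρ, hSm, hS⟩ := hrange.exists_measurable_mem
  classical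
  have hrS : ∀ p, ∃ y : X, p ∈ S → stoneCechUnit y = p := fun p => by
    by_cases hp : p ∈ S
    · obtain ⟨y, hy⟩ := hS p hp
      exact ⟨y, fun _ => hy⟩
    · exact ⟨Classical.arbitrary X, fun h => absurd h hp⟩
  choose r₀ hr₀ using hrS
  let r : StoneCech X → X := S.piecewise r₀ fun _ => Classical.arbitrary X
  have hr : ∀ p ∈ S, stoneCechUnit (r p) = p := fun p hp => by
    simp only [r, piecewise_eq_of_mem _ _ _ hp]
    exact hr₀ p hp
  have hrm : Measurable r := by
    refine measurable_of_isOpen fun V hV => ?_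
    obtain ⟨W, hW, rfl⟩ := isEmbedding_stoneCechUnit.isOpen_iff.1 hV
    rw [show r = S.piecewise r₀ fun _ => Classical.arbitrary X from rfl, piecewise_preimage,
      Set.ite]
    refine MeasurableSet.union ?_ ((measurable_const (hV.measurableSet)).diff hSm)
    convert! hW.measurableSet.inter hSm using 1
    ext p
    simp only [mem_inter_iff, mem_preimage, and_congr_left_iff]
    intro hp
    rw [hr₀ p hp]
  have hF : ∀ f : X →ᵇ ℝ, ∫ y, f y ∂(ρ.map r) = l f := fun f => by
    obtain ⟨F, hF⟩ := f.exists_stoneCech_extension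
    rw [integral_map hrm.aemeasurable f.continuous.aestronglyMeasurable, ← hint' f F hF]
    refine integral_congr_ae ?_
    filter_upwards [hSρ] with p hp
    rw [← hF, hr p hp]
  have hprob : IsProbabilityMeasure (ρ.map r) := by
    have h1 := hF (BoundedContinuousFunction.const X 1)
    have : IsFiniteMeasure (ρ.map r) := inferInstance
    simp only [const_apply, integral_const, smul_eq_mul, mul_one, hl1] at h1
    exact ⟨by rw [← ofReal_measureReal, h1, ENNReal.ofReal_one]⟩
  exact ⟨⟨ρ.map r, hprob⟩, hF⟩

theorem ConcaveOn.exists_supergradient {E : Type*} [NormedAddCommGroup E] [NormedSpace ℝ E]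
    {V : E → ℝ} (hV : ConcaveOn ℝ univ V) (hc : Continuous V) (x : E) :
    ∃ l : E →L[ℝ] ℝ, ∀ y, V y ≤ V x + l (y - x) := by
  have hopen : IsOpen {p : E × ℝ | p.1 ∈ univ ∧ p.2 < V p.1} := by
    simpa using isOpen_lt continuous_snd (hc.comp continuous_fst)
  obtain ⟨L, hL⟩ := geometric_hahn_banach_open_point hV.convex_strict_hypograph hopen
    (x := (x, V x)) (by simp)
  have hsplit : ∀ y a, L (y, a) = L (y, 0) + a * L (0, 1) := fun y a => by
    rw [← smul_eq_mul, ← map_smul, ← map_add]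
    simp
  have hpos : 0 < L (0, 1) := by
    have := hL (x, V x - 1) (by simp)
    rw [hsplit x, hsplit x (V x)] at this
    linarith
  have hle : ∀ y, L (y, V y) ≤ L (x, V x) := fun y => by
    refine le_of_forall_pos_lt_add fun ε hε => ?_
    have := hL (y, V y - ε / L (0, 1)) (by simp; positivity)
    rw [hsplit y] at this ⊢
    rw [sub_mul, div_mul_cancel₀ _ hpos.ne'] at this
    linarith
  refine ⟨-(L (0, 1))⁻¹ • L.comp (ContinuousLinearMap.inl ℝ E ℝ), fun y => ?_⟩
  have h := hle y
  rw [hsplit y, hsplit x] at h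
  have hsub : L (y - x, 0) = L (y, 0) - L (x, 0) := by
    rw [← map_sub]
    simp
  have : V y - V x ≤ (L (0, 1))⁻¹ * (L (x, 0) - L (y, 0)) := by
    rw [← div_eq_inv_mul, le_div_iff₀ hpos]
    linarith
  simp only [_root_.smul_apply, ContinuousLinearMap.comp_apply,
    ContinuousLinearMap.inl_apply, hsub, smul_eq_mul]
  linarith

section Monetary

variable {X : Type*} [TopologicalSpace X] {V : (X →ᵇ ℝ) → ℝ}

theorem monetary_le_add_norm (hmono : ∀ f g : X →ᵇ ℝ, (∀ x, f x ≤ g x) → V f ≤ V g)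
    (hcash : ∀ (f : X →ᵇ ℝ) (a : ℝ), V (f + BoundedContinuousFunction.const X a) = V f + a)
    (f g : X →ᵇ ℝ) : V f ≤ V g + ‖f - g‖ := by
  rw [← hcash]
  refine hmono _ _ fun x => ?_
  have := (le_abs_self _).trans ((f - g).norm_coe_le_norm x)
  simp only [BoundedContinuousFunction.coe_sub, Pi.sub_apply] at this
  simp only [BoundedContinuousFunction.coe_add, Pi.add_apply, const_apply]
  linarith

theorem exists_monetary_supergradient
    (hconc : ∀ f g : X →ᵇ ℝ, ∀ t : ℝ, 0 ≤ t → t ≤ 1 →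
      t * V f + (1 - t) * V g ≤ V (t • f + (1 - t) • g))
    (hmono : ∀ f g : X →ᵇ ℝ, (∀ x, f x ≤ g x) → V f ≤ V g)
    (hcash : ∀ (f : X →ᵇ ℝ) (a : ℝ), V (f + BoundedContinuousFunction.const X a) = V f + a)
    (f : X →ᵇ ℝ) :
    ∃ l : (X →ᵇ ℝ) →ₗ[ℝ] ℝ, (∀ g : X →ᵇ ℝ, (∀ x, 0 ≤ g x) → 0 ≤ l g) ∧
      l (BoundedContinuousFunction.const X 1) = 1 ∧ ∀ g, V g ≤ V f + l (g - f) := by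
  have hc : Continuous V := by
    refine LipschitzWith.continuous (K := 1) (LipschitzWith.of_le_add fun g h => ?_)
    rw [dist_eq_norm]
    exact monetary_le_add_norm hmono hcash g h
  have hcv : ConcaveOn ℝ univ V := by
    refine ⟨convex_univ, fun g _ h _ a b ha hb hab => ?_⟩
    obtain rfl : b = 1 - a := by linarith
    exact hconc g h a ha (by linarith)
  obtain ⟨l, hl⟩ := hcv.exists_supergradient hc f
  refine ⟨l, fun g hg => ?_, ?_, hl⟩
  · have h1 := hl (f + g)
    have h2 := hmono f (f + g) fun x => by simpa using hg x
    rw [add_sub_cancel_left] at h1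
    change 0 ≤ l g
    linarith
  · have h1 := hl (f + BoundedContinuousFunction.const X 1)
    have h2 := hl (f + BoundedContinuousFunction.const X (-1))
    rw [hcash, add_sub_cancel_left] at h1 h2
    have h3 : BoundedContinuousFunction.const X (-1 : ℝ) = -BoundedContinuousFunction.const X 1 := by
      ext; simp
    rw [h3, map_neg] at h2
    change l _ = 1
    linarith

end Monetary

/-- For a positive `ε`, a monetary utility function which is continuous from above has an
`ε`-supergradient at every point which is integration against a probability measure. -/
theorem exists_approx_supergradient {X : Type*} [TopologicalSpace X] [PolishSpace X] [Nonempty X]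
    [MeasurableSpace X] [BorelSpace X] {u : (X →ᵇ ℝ) → ℝ}
    (hconc : ∀ f g : X →ᵇ ℝ, ∀ t : ℝ, 0 ≤ t → t ≤ 1 →
      t * u f + (1 - t) * u g ≤ u (t • f + (1 - t) • g))
    (hmono : ∀ f g : X →ᵇ ℝ, (∀ x, f x ≤ g x) → u f ≤ u g)
    (hcash : ∀ (f : X →ᵇ ℝ) (a : ℝ), u (f + BoundedContinuousFunction.const X a) = u f + a)
    (hlim : ∀ (f : ℕ → X →ᵇ ℝ) (g : X →ᵇ ℝ),
      (∀ x, Antitone fun n => f n x) → (∀ x, Tendsto (fun n => f n x) atTop (𝓝 (g x))) →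
      Tendsto (fun n => u (f n)) atTop (𝓝 (u g)))
    (f : X →ᵇ ℝ) {ε : ℝ} (hε : 0 < ε) :
    ∃ μ : ProbabilityMeasure X, ∀ g : X →ᵇ ℝ,
      u g - ∫ x, g x ∂μ.toMeasure ≤ u f + ε - ∫ x, f x ∂μ.toMeasure := by
  let := TopologicalSpace.upgradeIsCompletelyMetrizable X
  let x := TopologicalSpace.denseSeq X
  have hx : DenseRange x := TopologicalSpace.denseRange_denseSeq X
  have hstep : ∀ (m : ℕ) (k : X →ᵇ ℝ), ∃ j,
      u (f + (k + (2 ^ m : ℝ) • truncatedInfDist x m j)) ≤ u (f + k) + ε / 2 * (1 / 2) ^ m := by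
    intro m k
    have := hlim (fun j => f + (k + (2 ^ m : ℝ) • truncatedInfDist x m j)) (f + k)
      (fun y i j hij => by
        have := antitone_truncatedInfDist x m y hij
        simp only [BoundedContinuousFunction.coe_add, BoundedContinuousFunction.coe_smul,
          Pi.add_apply, smul_eq_mul]
        gcongr)
      (fun y => by
        have := ((tendsto_truncatedInfDist m hx y).const_mul (2 ^ m : ℝ)).const_add (f y + k y)
        simpa [add_assoc] using this)
    obtain ⟨j, hj⟩ := (this.eventually_le_const
      (lt_add_of_pos_right (u (f + k)) (by positivity : 0 < ε / 2 * (1 / 2) ^ m))).exists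
    exact ⟨j, hj⟩
  choose J hJ using hstep
  let h : ℕ → X →ᵇ ℝ := Nat.rec 0 fun m k => k + (2 ^ m : ℝ) • truncatedInfDist x m (J m k)
  have hsucc : ∀ m, h (m + 1) = h m + (2 ^ m : ℝ) • truncatedInfDist x m (J m (h m)) :=
    fun m => rfl
  have hh_mono : ∀ y, Monotone fun m => h m y := fun y => monotone_nat_of_le_succ fun m => by
    have := truncatedInfDist_nonneg x m (J m (h m)) y
    simp only [hsucc, BoundedContinuousFunction.coe_add, BoundedContinuousFunction.coe_smul,
      Pi.add_apply, smul_eq_mul]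
    have : 0 ≤ 2 ^ m * truncatedInfDist x m (J m (h m)) y := by positivity
    linarith
  have hh_nonneg : ∀ m y, 0 ≤ h m y := fun m y => hh_mono y (Nat.zero_le m)
  have hub : ∀ m, u (f + h m) ≤ u f + ε - ε * (1 / 2) ^ m := by
    intro m
    induction m with
    | zero => simp [h]
    | succ m ih =>
      have := hJ m (h m)
      rw [← hsucc] at this
      rw [pow_succ]
      linarith
  have humono : ∀ g, Monotone fun m => u (g + h m) := fun g m n hmn =>
    hmono _ _ fun y => by
      have := hh_mono y hmn
      simpa using this
  have hbdd : ∀ g, BddAbove (range fun m => u (g + h m)) := by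
    intro g
    refine ⟨u f + ε + ‖g - f‖, ?_⟩
    rintro _ ⟨m, rfl⟩
    have h1 := monetary_le_add_norm hmono hcash (g + h m) (f + h m)
    rw [add_sub_add_right_eq_sub] at h1
    have h2 := hub m
    have : 0 ≤ ε * (1 / 2) ^ m := by positivity
    dsimp only
    linarith
  let V : (X →ᵇ ℝ) → ℝ := fun g => ⨆ m, u (g + h m)
  have hV : ∀ g, Tendsto (fun m => u (g + h m)) atTop (𝓝 (V g)) := fun g =>
    tendsto_atTop_ciSup (humono g) (hbdd g)
  have huV : ∀ g m, u (g + h m) ≤ V g := fun g m => le_ciSup (hbdd g) m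
  have hVf : V f ≤ u f + ε := ciSup_le fun m => by
    have := hub m
    have : 0 ≤ ε * (1 / 2) ^ m := by positivity
    linarith
  obtain ⟨l, hl, hl1, hlV⟩ := exists_monetary_supergradient (V := V)
    (fun g k t ht0 ht1 => by
      refine le_of_tendsto_of_tendsto' (((hV g).const_mul t).add ((hV k).const_mul (1 - t)))
        (hV _) fun m => (hconc _ _ t ht0 ht1).trans_eq ?_
      congr 1
      module)
    (fun g k hgk => le_of_tendsto_of_tendsto' (hV g) (hV k) fun m =>
      hmono _ _ fun y => by simpa using hgk y)
    (fun g a => tendsto_nhds_unique (hV _) (((hV g).add_const a).congr fun m => by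
      rw [← hcash, add_right_comm]))
    f
  have hkey : ∀ g m, u g ≤ u f + ε + l g - l f - l (h m) := fun g m => by
    have h1 := huV (g - h m) m
    have h2 := hlV (g - h m)
    rw [sub_add_cancel] at h1
    rw [map_sub, map_sub] at h2
    linarith
  obtain ⟨μ, hμ⟩ := exists_probabilityMeasure_of_tight l hl hl1 x (fun m => J m (h m))
    (u f + ε - l f - u 0) (fun m => by
      have h1 := hkey 0 (m + 1)
      rw [hsucc, map_add, map_smul, smul_eq_mul, map_zero] at h1
      have h2 := hl (h m) (hh_nonneg m)
      linarith)
  refine ⟨μ, fun g => ?_⟩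
  rw [hμ, hμ]
  have := hkey g 0
  have h2 := hl (h 0) (hh_nonneg 0)
  linarith

/-- The minimal penalty function of `u`. -/
noncomputable def minimalPenalty {X : Type*} [TopologicalSpace X] [MeasurableSpace X]
    (u : (X →ᵇ ℝ) → ℝ) (μ : ProbabilityMeasure X) : ENNReal :=
  ⨆ g : X →ᵇ ℝ, ENNReal.ofReal (u g - ∫ x, g x ∂μ.toMeasure)

theorem le_integral_add_minimalPenalty {X : Type*} [TopologicalSpace X] [MeasurableSpace X]
    {u : (X →ᵇ ℝ) → ℝ} {μ : ProbabilityMeasure X}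
    (hμ : minimalPenalty u μ ≠ ⊤) (f : X →ᵇ ℝ) :
    u f ≤ ∫ x, f x ∂μ.toMeasure + (minimalPenalty u μ).toReal := by
  have := (ENNReal.ofReal_le_iff_le_toReal hμ).1
    (le_iSup (fun g : X →ᵇ ℝ => ENNReal.ofReal (u g - ∫ x, g x ∂μ.toMeasure)) f)
  linarith

section MinimalPenalty

variable {X : Type*} [TopologicalSpace X] [MeasurableSpace X] [OpensMeasurableSpace X]
  (u : (X →ᵇ ℝ) → ℝ)

theorem lowerSemicontinuous_minimalPenalty : LowerSemicontinuous (minimalPenalty u) :=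
  lowerSemicontinuous_iSup fun g => (ENNReal.continuous_ofReal.comp (continuous_const.sub
    (ProbabilityMeasure.continuous_integral_boundedContinuousFunction g))).lowerSemicontinuous

theorem minimalPenalty_le_of_eq_add (μ ν : ProbabilityMeasure X) (t : NNReal) (ht : t ≤ 1)
    (σ : ProbabilityMeasure X)
    (hσ : σ.toMeasure = t • μ.toMeasure + (1 - t) • ν.toMeasure) :
    minimalPenalty u σ ≤ t * minimalPenalty u μ + (1 - t) * minimalPenalty u ν := by
  refine iSup_le fun g => ?_
  have hint : ∫ x, g x ∂σ.toMeasure =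
      t * ∫ x, g x ∂μ.toMeasure + (1 - t : NNReal) * ∫ x, g x ∂ν.toMeasure := by
    rw [hσ, integral_add_measure, integral_smul_nnreal_measure, integral_smul_nnreal_measure]
    · rfl
    · exact (g.integrable _).smul_measure_nnreal
    · exact (g.integrable _).smul_measure_nnreal
  have hsplit : u g - ∫ x, g x ∂σ.toMeasure = t * (u g - ∫ x, g x ∂μ.toMeasure) +
      (1 - t : NNReal) * (u g - ∫ x, g x ∂ν.toMeasure) := by
    rw [hint, NNReal.coe_sub ht, NNReal.coe_one]
    ring
  rw [hsplit]
  refine ENNReal.ofReal_add_le.trans ?_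
  rw [ENNReal.ofReal_mul t.coe_nonneg, ENNReal.ofReal_mul (1 - t).coe_nonneg,
    ENNReal.ofReal_coe_nnreal, ENNReal.ofReal_coe_nnreal, ENNReal.coe_sub, ENNReal.coe_one]
  gcongr
  · exact le_iSup (fun g : X →ᵇ ℝ => ENNReal.ofReal (u g - ∫ x, g x ∂μ.toMeasure)) g
  · exact le_iSup (fun g : X →ᵇ ℝ => ENNReal.ofReal (u g - ∫ x, g x ∂ν.toMeasure)) g

end MinimalPenalty

/-- A concave monetary utility function on C_b(X) with the Fatou property, X Polish, admits
a convex weak*-lower-semicontinuous penalty function c on the Borel probability measures of X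
with u(f) = inf {∫ f dμ + c(μ)}. -/
theorem concave_utility_representation
    {X : Type*} [TopologicalSpace X] [PolishSpace X]
    [MeasurableSpace X] [BorelSpace X]
    (u : (X →ᵇ ℝ) → ℝ)
    (hconc : ∀ f g : X →ᵇ ℝ, ∀ t : ℝ, 0 ≤ t → t ≤ 1 →
      t * u f + (1 - t) * u g ≤ u (t • f + (1 - t) • g))
    (hpos : ∀ f : X →ᵇ ℝ, (∀ x, 0 ≤ f x) → 0 ≤ u f)
    (hcash : ∀ f : X →ᵇ ℝ, ∀ a : ℝ, u (f + BoundedContinuousFunction.const X a) = u f + a)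
    (hFatou : ∀ (f : ℕ → X →ᵇ ℝ) (g : X →ᵇ ℝ),
      (∀ x, Antitone fun n => f n x) → (∀ x, Tendsto (fun n => f n x) atTop (nhds (g x))) →
      Antitone (fun n => u (f n)) ∧ Tendsto (fun n => u (f n)) atTop (nhds (u g))) :
    ∃ c : ProbabilityMeasure X → ENNReal,
      LowerSemicontinuous c ∧
      (∀ μ ν : ProbabilityMeasure X, ∀ t : NNReal, t ≤ 1 →
        ∀ σ : ProbabilityMeasure X,
          σ.toMeasure = t • μ.toMeasure + (1 - t) • ν.toMeasure →
          c σ ≤ t * c μ + (1 - t) * c ν) ∧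
      ∀ f : X →ᵇ ℝ,
        u f = sInf {r : ℝ | ∃ μ : ProbabilityMeasure X,
          c μ ≠ ⊤ ∧ r = ∫ x, f x ∂μ.toMeasure + (c μ).toReal} := by
  have hmono : ∀ f g : X →ᵇ ℝ, (∀ x, f x ≤ g x) → u f ≤ u g := by
    intro f g hfg
    have h := (hFatou (fun n => if n = 0 then g else f) f
      (fun x => antitone_nat_of_succ_le fun n => by
        rcases n with _ | n
        · simpa using hfg x
        · simp)
      (fun x => tendsto_const_nhds.congr' (by
        filter_upwards [eventually_ne_atTop 0] with n hn
        simp [hn]))).1 (Nat.zero_le 1)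
    simpa using h
  have hne : Nonempty X := by
    by_contra hX
    rw [not_nonempty_iff] at hX
    have h := hcash 0 1
    rw [show 0 + BoundedContinuousFunction.const X (1 : ℝ) = 0 from
      BoundedContinuousFunction.ext isEmptyElim] at h
    linarith
  refine ⟨minimalPenalty u, lowerSemicontinuous_minimalPenalty u, minimalPenalty_le_of_eq_add u,
    fun f => ?_⟩
  have happrox : ∀ ε > 0, ∃ μ : ProbabilityMeasure X, minimalPenalty u μ ≠ ⊤ ∧
      ∫ x, f x ∂μ.toMeasure + (minimalPenalty u μ).toReal ≤ u f + ε := by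
    intro ε hε
    obtain ⟨μ, hμ⟩ := exists_approx_supergradient hconc hmono hcash
      (fun k g h₁ h₂ => (hFatou k g h₁ h₂).2) f hε
    have hle : minimalPenalty u μ ≤ ENNReal.ofReal (u f + ε - ∫ x, f x ∂μ.toMeasure) :=
      iSup_le fun g => ENNReal.ofReal_le_ofReal (hμ g)
    have h0 : 0 ≤ u f + ε - ∫ x, f x ∂μ.toMeasure := by
      have h1 := hμ 0
      have h2 := hpos 0 fun _ => le_rfl
      simp only [BoundedContinuousFunction.coe_zero, Pi.zero_apply, integral_zero, sub_zero] at h1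
      linarith
    refine ⟨μ, ne_top_of_le_ne_top ENNReal.ofReal_ne_top hle, ?_⟩
    have := ENNReal.toReal_le_of_le_ofReal h0 hle
    linarith
  have hglb : IsGLB {r : ℝ | ∃ μ : ProbabilityMeasure X, minimalPenalty u μ ≠ ⊤ ∧
      r = ∫ x, f x ∂μ.toMeasure + (minimalPenalty u μ).toReal} (u f) := by
    constructor
    · rintro _ ⟨μ, hμ, rfl⟩
      exact le_integral_add_minimalPenalty hμ f
    · intro b hb
      refine le_of_forall_pos_le_add fun ε hε => ?_
      obtain ⟨μ, hμ, hle⟩ := happrox ε hε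
      exact (hb ⟨μ, hμ, rfl⟩).trans hle
  obtain ⟨μ, hμ, -⟩ := happrox 1 one_pos
  exact (hglb.csInf_eq ⟨_, μ, hμ, rfl⟩).symm
end
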